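/- Let ξ, δ ∈ ℝ and let ψ(t,y) = (y²/t)^ε e^{−c y²/t} with some fixed c, ε > 0. Consider the maximal operator T_ψ^ξ f(x) = sup_{t>0} | x^ξ ∫_x^∞ f(y) ψ(t,y) y^{−ξ−1} dy | on the measure space (ℝ₊, x^δ dx). Then: (a) T_ψ^ξ is of strong type (p,p) when 1 < p < ∞ and −ξp − 1 < δ; (b) T_ψ^ξ is of strong type (∞,∞) if ξ ≥ 0; (c) T_ψ^ξ is of weak type (p,p) when 1 ≤ p < ∞ and −ξp − 1 ≤ δ, with the last inequality strictened to −ξp − 1 < δ in case ξ = 0. -/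

import Mathlib

open MeasureTheory Set ENNReal
open scoped NNReal

noncomputable section

/-- The measure `x^δ dx` on `(0,∞)`. -/
def powMeasure (δ : ℝ) : Measure ℝ :=
  (volume.restrict (Ioi (0:ℝ))).withDensity (fun x => ENNReal.ofReal (x ^ δ))

/-- `f ∈ L^p(ℝ₊, x^δ dx)` for a real exponent `p`. -/
def MemLpPow (f : ℝ → ℝ) (p δ : ℝ) : Prop :=
  AEMeasurable f (powMeasure δ) ∧
    ∫⁻ x, ENNReal.ofReal |f x| ^ p ∂(powMeasure δ) < ⊤

/-- `T` is of strong type `(p,p)` with respect to `(ℝ₊, x^δ dx)`. -/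
def IsStrongType (T : (ℝ → ℝ) → (ℝ → ℝ)) (p δ : ℝ) : Prop :=
  ∃ C : ℝ≥0, ∀ f : ℝ → ℝ, MemLpPow f p δ →
    ∫⁻ x, ENNReal.ofReal |T f x| ^ p ∂(powMeasure δ) ≤
      C * ∫⁻ x, ENNReal.ofReal |f x| ^ p ∂(powMeasure δ)

/-- `T` is of strong type `(∞,∞)`, i.e. bounded on `L^∞(ℝ₊, dx)`. -/
def IsStrongTypeInfty (T : (ℝ → ℝ) → (ℝ → ℝ)) : Prop :=
  ∃ C : ℝ≥0, ∀ f : ℝ → ℝ,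
    eLpNorm (T f) ⊤ (volume.restrict (Ioi (0:ℝ))) ≤
      C * eLpNorm f ⊤ (volume.restrict (Ioi (0:ℝ)))

/-- `T` is of weak type `(p,p)` with respect to `(ℝ₊, x^δ dx)`. -/
def IsWeakType (T : (ℝ → ℝ) → (ℝ → ℝ)) (p δ : ℝ) : Prop :=
  ∃ C : ℝ≥0, ∀ f : ℝ → ℝ, MemLpPow f p δ → ∀ l : ℝ, 0 < l →
    ENNReal.ofReal (l ^ p) * powMeasure δ {y | l < |T f y|} ≤
      C * ∫⁻ x, ENNReal.ofReal |f x| ^ p ∂(powMeasure δ)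

/-- `T` is of restricted weak type `(p,p)` with respect to `(ℝ₊, x^δ dx)`:
the weak type inequality holds uniformly over indicator functions of sets of
finite `x^δ dx` measure. -/
def IsRestrictedWeakType (T : (ℝ → ℝ) → (ℝ → ℝ)) (p δ : ℝ) : Prop :=
  ∃ C : ℝ≥0, ∀ E : Set ℝ, MeasurableSet E → powMeasure δ E < ⊤ → ∀ l : ℝ, 0 < l →
    ENNReal.ofReal (l ^ p) * powMeasure δ {y | l < |T (E.indicator 1) y|} ≤
      C * powMeasure δ E

/-- The maximal operator `T_ψ^ξ` with `ψ(t,y) = (y²/t)^ε e^{-c y²/t}`. -/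
def Tpsi (c ε ξ : ℝ) (f : ℝ → ℝ) (x : ℝ) : ℝ≥0∞ :=
  ⨆ t ∈ Ioi (0:ℝ), ENNReal.ofReal
    |x ^ ξ * ∫ y in Ioi x, f y * ((y ^ 2 / t) ^ ε * Real.exp (-(c * y ^ 2) / t)) * y ^ (-ξ - 1)|


lemma setLIntegral_Ioi_rpow {x s : ℝ} (hx : 0 < x) (hs : s < -1) :
    ∫⁻ y in Ioi x, ENNReal.ofReal (y ^ s) = ENNReal.ofReal (x ^ (s + 1) / -(s + 1)) := by
  rw [← ofReal_integral_eq_lintegral_ofReal (integrableOn_Ioi_rpow_of_lt hs hx),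
    integral_Ioi_rpow_of_lt hs hx, neg_div, div_neg]
  filter_upwards [ae_restrict_mem measurableSet_Ioi] with y hy
  exact Real.rpow_nonneg (hx.trans hy).le _

lemma setLIntegral_Ioo_rpow {y s : ℝ} (hy : 0 < y) (hs : -1 < s) :
    ∫⁻ x in Ioo 0 y, ENNReal.ofReal (x ^ s) = ENNReal.ofReal (y ^ (s + 1) / (s + 1)) := by
  rw [← ofReal_integral_eq_lintegral_ofReal
      ((intervalIntegral.integrableOn_Ioo_rpow_iff hy).2 hs),
    ← integral_Ioc_eq_integral_Ioo, ← intervalIntegral.integral_of_le hy.le,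
    integral_rpow (Or.inl hs), Real.zero_rpow (by linarith), sub_zero]
  filter_upwards [ae_restrict_mem measurableSet_Ioo] with x hx
  exact Real.rpow_nonneg hx.1.le _

/-- Jensen's inequality for the unnormalised weight `w`. -/
lemma lintegral_mul_rpow_le {α : Type*} [MeasurableSpace α] {μ : Measure α} {h w : α → ℝ≥0∞}
    (hh : Measurable h) (hw : Measurable w) {p : ℝ} (hp : 1 ≤ p) :
    (∫⁻ a, h a * w a ∂μ) ^ p ≤ (∫⁻ a, w a ∂μ) ^ (p - 1) * ∫⁻ a, h a ^ p * w a ∂μ := by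
  have hp0 : 0 < p := by linarith
  have key := eLpNorm'_le_eLpNorm'_mul_rpow_measure_univ (μ := μ.withDensity w) one_pos hp
    hh.aestronglyMeasurable
  have e1 : ∫⁻ a, h a ∂μ.withDensity w = ∫⁻ a, h a * w a ∂μ := by
    rw [lintegral_withDensity_eq_lintegral_mul _ hw hh]
    simp only [Pi.mul_apply, mul_comm]
  have e2 : ∫⁻ a, h a ^ p ∂μ.withDensity w = ∫⁻ a, h a ^ p * w a ∂μ := by
    rw [lintegral_withDensity_eq_lintegral_mul _ hw (hh.pow_const p)]
    simp only [Pi.mul_apply, mul_comm]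
  simp only [eLpNorm', enorm_eq_self, ENNReal.rpow_one, div_one, withDensity_apply _
    MeasurableSet.univ, Measure.restrict_univ, e1, e2] at key
  calc _ ≤ _ := ENNReal.rpow_le_rpow key hp0.le
    _ = _ := by
      rw [ENNReal.mul_rpow_of_nonneg _ _ hp0.le, ← ENNReal.rpow_mul, ← ENNReal.rpow_mul, mul_comm]
      congr 2
      · field_simp
      · rw [one_div_mul_cancel hp0.ne', ENNReal.rpow_one]

lemma lintegral_Ioi_mul_lintegral_Ioi {A G : ℝ → ℝ≥0∞} (hA : Measurable A) (hG : Measurable G) :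
    ∫⁻ x in Ioi 0, A x * ∫⁻ y in Ioi x, G y =
      ∫⁻ y in Ioi 0, G y * ∫⁻ x in Ioo 0 y, A x := by
  have hm : Measurable (Function.uncurry fun x y : ℝ =>
      {q : ℝ × ℝ | q.1 < q.2}.indicator (fun q => A q.1 * G q.2) (x, y)) :=
    ((hA.comp measurable_fst).mul (hG.comp measurable_snd)).indicator
      (measurableSet_lt measurable_fst measurable_snd)
  have key := lintegral_lintegral_swap (μ := volume.restrict (Ioi (0:ℝ)))
    (ν := volume.restrict (Ioi (0:ℝ))) hm.aemeasurable
  convert key using 1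
  · refine setLIntegral_congr_fun measurableSet_Ioi fun x hx => ?_
    have : ∀ y, {q : ℝ × ℝ | q.1 < q.2}.indicator (fun q => A q.1 * G q.2) (x, y) =
        (Ioi x).indicator (fun y => A x * G y) y := fun y => by
      simp [indicator_apply]
    simp only [this]
    rw [lintegral_indicator measurableSet_Ioi, Measure.restrict_restrict measurableSet_Ioi,
      inter_eq_left.2 (Ioi_subset_Ioi (le_of_lt hx)), lintegral_const_mul _ hG]
  · refine setLIntegral_congr_fun measurableSet_Ioi fun y hy => ?_
    have : ∀ x, {q : ℝ × ℝ | q.1 < q.2}.indicator (fun q => A q.1 * G q.2) (x, y) =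
        (Iio y).indicator (fun x => G y * A x) x := fun x => by
      simp [indicator_apply, mul_comm]
    simp only [this]
    rw [lintegral_indicator measurableSet_Iio, Measure.restrict_restrict measurableSet_Iio,
      Iio_inter_Ioi, lintegral_const_mul _ hA]

lemma lintegral_powMeasure (δ : ℝ) (h : ℝ → ℝ≥0∞) :
    ∫⁻ x, h x ∂powMeasure δ = ∫⁻ x in Ioi (0:ℝ), ENNReal.ofReal (x ^ δ) * h x :=
  lintegral_withDensity_eq_lintegral_mul_non_measurable _ (by fun_prop) (by simp) h

lemma powMeasure_absolutelyContinuous (δ : ℝ) :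
    powMeasure δ ≪ volume.restrict (Ioi (0:ℝ)) :=
  withDensity_absolutelyContinuous _ _

lemma absolutelyContinuous_powMeasure (δ : ℝ) :
    volume.restrict (Ioi (0:ℝ)) ≪ powMeasure δ := by
  refine withDensity_absolutelyContinuous' (by fun_prop) ?_
  filter_upwards [ae_restrict_mem measurableSet_Ioi] with x hx
  simpa using Real.rpow_pos_of_pos hx δ

/-- The dual Hardy operator `x ^ ξ * ∫_x^∞ g(y) y ^ (-ξ - 1) dy`. -/
def hardyDual (ξ : ℝ) (g : ℝ → ℝ≥0∞) (x : ℝ) : ℝ≥0∞ :=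
  ENNReal.ofReal (x ^ ξ) * ∫⁻ y in Ioi x, g y * ENNReal.ofReal (y ^ (-ξ - 1))

lemma measurable_hardyDual (ξ : ℝ) (g : ℝ → ℝ≥0∞) : Measurable (hardyDual ξ g) := by
  refine Measurable.mul (by fun_prop) (Antitone.measurable fun a b hab => ?_)
  exact lintegral_mono_set (Ioi_subset_Ioi hab)

lemma lintegral_hardyDual_rpow_le {ξ δ p : ℝ} (hp : 1 ≤ p) (hδ : -ξ * p - 1 < δ) :
    ∃ C : ℝ≥0, ∀ g : ℝ → ℝ≥0∞, Measurable g →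
      ∫⁻ x, hardyDual ξ g x ^ p ∂powMeasure δ ≤ C * ∫⁻ x, g x ^ p ∂powMeasure δ := by
  have hp0 : 0 < p := by linarith
  obtain ⟨b, hb⟩ : ∃ b : ℝ, b * p = ξ * p + δ + 1 :=
    ⟨(ξ * p + δ + 1) / p, by field_simp⟩
  have hb0 : 0 < b := by
    by_contra h
    nlinarith
  have hp1 : 0 ≤ p - 1 := by linarith
  refine ⟨Real.toNNReal (b⁻¹ ^ (p - 1) * b⁻¹), fun g hg => ?_⟩
  have hpt : ∀ x ∈ Ioi (0:ℝ), ENNReal.ofReal (x ^ δ) * hardyDual ξ g x ^ p ≤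
      ENNReal.ofReal (b⁻¹ ^ (p - 1)) * (ENNReal.ofReal (x ^ (b - 1)) *
        ∫⁻ y in Ioi x, g y ^ p * ENNReal.ofReal (y ^ (δ - b))) := by
    intro x hx
    have hx : 0 < x := hx
    have e1 : ∫⁻ y in Ioi x, g y * ENNReal.ofReal (y ^ (-ξ - 1)) =
        ∫⁻ y in Ioi x, (g y * ENNReal.ofReal (y ^ (b - ξ))) * ENNReal.ofReal (y ^ (-1 - b)) := by
      refine setLIntegral_congr_fun measurableSet_Ioi fun y hy => ?_
      have hy : 0 < y := hx.trans hy
      rw [mul_assoc, ← ENNReal.ofReal_mul (by positivity), ← Real.rpow_add hy]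
      ring_nf
    have e2 := lintegral_mul_rpow_le (μ := volume.restrict (Ioi x))
      (h := fun y => g y * ENNReal.ofReal (y ^ (b - ξ)))
      (w := fun y => ENNReal.ofReal (y ^ (-1 - b))) (by fun_prop) (by fun_prop) hp
    have e3 : ∫⁻ y in Ioi x, (g y * ENNReal.ofReal (y ^ (b - ξ))) ^ p *
        ENNReal.ofReal (y ^ (-1 - b)) =
        ∫⁻ y in Ioi x, g y ^ p * ENNReal.ofReal (y ^ (δ - b)) := by
      refine setLIntegral_congr_fun measurableSet_Ioi fun y hy => ?_
      have hy : 0 < y := hx.trans hy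
      rw [ENNReal.mul_rpow_of_nonneg _ _ hp0.le, mul_assoc,
        ENNReal.ofReal_rpow_of_pos (by positivity), ← ENNReal.ofReal_mul (by positivity),
        ← Real.rpow_mul hy.le, ← Real.rpow_add hy]
      have : (b - ξ) * p + (-1 - b) = δ - b := by linarith
      rw [this]
    rw [e3, setLIntegral_Ioi_rpow hx (by linarith)] at e2
    rw [hardyDual, e1, ENNReal.mul_rpow_of_nonneg _ _ hp0.le]
    refine (mul_le_mul_right (mul_le_mul_right e2 _) _).trans (le_of_eq ?_)
    rw [ENNReal.ofReal_rpow_of_pos (by positivity), ENNReal.ofReal_rpow_of_pos (by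
      have : -(-1 - b + 1) = b := by ring
      rw [this]; positivity)]
    simp only [← mul_assoc]
    congr 1
    rw [← ENNReal.ofReal_mul (by positivity), ← ENNReal.ofReal_mul (by positivity),
      ← ENNReal.ofReal_mul (by positivity)]
    congr 1
    have : -(-1 - b + 1) = b := by ring
    rw [this, div_eq_mul_inv, Real.mul_rpow (by positivity) (by positivity), ← Real.rpow_mul hx.le,
      ← Real.rpow_mul hx.le, ← mul_assoc, ← Real.rpow_add hx, ← Real.rpow_add hx, mul_comm]
    congr 2
    linarith
  rw [lintegral_powMeasure, lintegral_powMeasure]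
  calc _ ≤ ∫⁻ x in Ioi (0:ℝ), ENNReal.ofReal (b⁻¹ ^ (p - 1)) * (ENNReal.ofReal (x ^ (b - 1)) *
        ∫⁻ y in Ioi x, g y ^ p * ENNReal.ofReal (y ^ (δ - b))) :=
        setLIntegral_mono' measurableSet_Ioi hpt
    _ = ENNReal.ofReal (b⁻¹ ^ (p - 1)) * ∫⁻ y in Ioi (0:ℝ), ENNReal.ofReal b⁻¹ *
          (ENNReal.ofReal (y ^ δ) * g y ^ p) := by
        rw [lintegral_const_mul' _ _ ENNReal.ofReal_ne_top,
          lintegral_Ioi_mul_lintegral_Ioi (by fun_prop) (by fun_prop)]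
        congr 1
        refine setLIntegral_congr_fun measurableSet_Ioi fun y hy => ?_
        have hy : 0 < y := hy
        rw [setLIntegral_Ioo_rpow hy (by linarith), mul_assoc, ← ENNReal.ofReal_mul (by positivity),
          mul_comm, ← mul_assoc, ← ENNReal.ofReal_mul (by positivity)]
        congr 2
        rw [sub_add_cancel, mul_div_assoc', ← Real.rpow_add hy, sub_add_cancel, div_eq_inv_mul]
    _ = _ := by
        rw [lintegral_const_mul' _ _ ENNReal.ofReal_ne_top, ← mul_assoc,
          ← ENNReal.ofReal_mul (by positivity)]
        rfl

lemma rpow_mul_exp_neg_le {c ε t : ℝ} (hc : 0 < c) (hε : 0 < ε) (ht : 0 < t) (y : ℝ) :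
    (y ^ 2 / t) ^ ε * Real.exp (-(c * y ^ 2) / t) ≤ (ε / c) ^ ε := by
  have hu : 0 ≤ y ^ 2 / t := by positivity
  set u := y ^ 2 / t with hu'
  have e1 : -(c * y ^ 2) / t = -(c * u) := by rw [hu']; ring
  have e2 : c * u / ε ≤ Real.exp (c * u / ε) := by
    linarith [Real.add_one_le_exp (c * u / ε)]
  have e3 : (c * u / ε) ^ ε ≤ Real.exp (c * u) := by
    refine (Real.rpow_le_rpow (by positivity) e2 hε.le).trans (le_of_eq ?_)
    rw [← Real.exp_mul, div_mul_cancel₀ _ hε.ne']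
  have e4 : u ^ ε = (ε / c) ^ ε * (c * u / ε) ^ ε := by
    rw [← Real.mul_rpow (by positivity) (by positivity)]
    congr 1
    field_simp
  rw [e1, e4, mul_assoc, Real.exp_neg]
  refine mul_le_of_le_one_right (by positivity) ?_
  rw [← div_eq_mul_inv]
  exact (div_le_one (Real.exp_pos _)).2 e3

lemma lintegral_rpow_mul_exp_neg {c ε t : ℝ} (hc : 0 < c) (hε : 0 < ε) (ht : 0 < t) :
    ∫⁻ y in Ioi (0:ℝ), ENNReal.ofReal ((y ^ 2 / t) ^ ε * Real.exp (-(c * y ^ 2) / t) * y⁻¹) =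
      ENNReal.ofReal (c ^ (-ε) * (1 / 2) * Real.Gamma ε) := by
  have hq : -1 < 2 * ε - 1 := by linarith
  have hint := (integrableOn_rpow_mul_exp_neg_mul_rpow hq two_pos (div_pos hc ht)).const_mul
    (t ^ (-ε))
  have e1 : ∀ y ∈ Ioi (0:ℝ), (y ^ 2 / t) ^ ε * Real.exp (-(c * y ^ 2) / t) * y⁻¹ =
      t ^ (-ε) * (y ^ (2 * ε - 1) * Real.exp (-(c / t) * y ^ (2:ℝ))) := by
    intro y hy
    have hy : 0 < y := hy
    rw [Real.div_rpow (by positivity) ht.le, Real.rpow_neg ht.le, Real.rpow_sub_one hy.ne',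
      Real.rpow_mul hy.le, Real.rpow_two]
    have : -(c * y ^ 2) / t = -(c / t) * y ^ 2 := by ring
    rw [this]
    ring
  rw [setLIntegral_congr_fun measurableSet_Ioi fun y hy => congrArg ENNReal.ofReal (e1 y hy),
    ← ofReal_integral_eq_lintegral_ofReal hint, integral_const_mul,
    integral_rpow_mul_exp_neg_mul_rpow two_pos hq (div_pos hc ht)]
  · congr 1
    have : (2 * ε - 1 + 1) / 2 = ε := by ring
    rw [neg_div, this, Real.div_rpow hc.le ht.le]
    have : t ^ (-ε) ≠ 0 := by positivity
    field_simp
  · filter_upwards [ae_restrict_mem measurableSet_Ioi] with y hy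
    have hy : 0 < y := hy
    simp only [Pi.zero_apply]
    positivity

lemma Tpsi_le_of_forall {c ε ξ x : ℝ} {f : ℝ → ℝ} {g : ℝ → ℝ≥0∞} {B : ℝ≥0∞} (hx : 0 < x)
    (hfg : ∀ᵐ y ∂volume.restrict (Ioi (0:ℝ)), ENNReal.ofReal |f y| ≤ g y)
    (hB : ∀ t > 0, ENNReal.ofReal (x ^ ξ) * ∫⁻ y in Ioi x, g y *
      ENNReal.ofReal ((y ^ 2 / t) ^ ε * Real.exp (-(c * y ^ 2) / t)) *
      ENNReal.ofReal (y ^ (-ξ - 1)) ≤ B) :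
    Tpsi c ε ξ f x ≤ B := by
  refine iSup₂_le fun t ht => le_trans ?_ (hB t ht)
  have ht : 0 < t := ht
  rw [abs_mul, abs_of_nonneg (Real.rpow_nonneg hx.le _), ENNReal.ofReal_mul (by positivity)]
  gcongr
  rw [← Real.enorm_eq_ofReal_abs]
  refine (enorm_integral_le_lintegral_enorm _).trans (lintegral_mono_ae ?_)
  filter_upwards [ae_restrict_of_ae_restrict_of_subset (Ioi_subset_Ioi hx.le) hfg,
    ae_restrict_mem measurableSet_Ioi] with y hy hxy
  have hy0 : 0 < y := hx.trans hxy
  rw [Real.enorm_eq_ofReal_abs, abs_mul, abs_mul, ENNReal.ofReal_mul (by positivity),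
    ENNReal.ofReal_mul (by positivity)]
  rw [abs_of_nonneg (a := y ^ (-ξ - 1)) (by positivity),
    abs_of_nonneg (a := _ * Real.exp _) (by positivity)]
  gcongr

lemma Tpsi_le_hardyDual {c ε ξ x : ℝ} (hc : 0 < c) (hε : 0 < ε) {f : ℝ → ℝ} {g : ℝ → ℝ≥0∞}
    (hfg : ∀ᵐ y ∂volume.restrict (Ioi (0:ℝ)), ENNReal.ofReal |f y| ≤ g y) (hx : 0 < x) :
    Tpsi c ε ξ f x ≤ ENNReal.ofReal ((ε / c) ^ ε) * hardyDual ξ g x := by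
  refine Tpsi_le_of_forall hx hfg fun t ht => ?_
  rw [hardyDual, mul_left_comm,
    ← lintegral_const_mul' (ENNReal.ofReal ((ε / c) ^ ε)) _ ENNReal.ofReal_ne_top]
  refine mul_le_mul_right (lintegral_mono fun y => ?_) _
  rw [mul_assoc, mul_left_comm]
  gcongr
  exact rpow_mul_exp_neg_le hc hε ht y

lemma Tpsi_le_eLpNorm_top {c ε ξ x : ℝ} (hc : 0 < c) (hε : 0 < ε) (hξ : 0 ≤ ξ) (f : ℝ → ℝ)
    (hx : 0 < x) :
    Tpsi c ε ξ f x ≤ ENNReal.ofReal (c ^ (-ε) * (1 / 2) * Real.Gamma ε) *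
      eLpNorm f ⊤ (volume.restrict (Ioi (0:ℝ))) := by
  set S := eLpNorm f ⊤ (volume.restrict (Ioi (0:ℝ))) with hS
  have hfS : ∀ᵐ y ∂volume.restrict (Ioi (0:ℝ)), ENNReal.ofReal |f y| ≤ S := by
    rw [hS, eLpNorm_exponent_top]
    filter_upwards [enorm_ae_le_eLpNormEssSup f (volume.restrict (Ioi (0:ℝ)))] with y hy
    rwa [← Real.enorm_eq_ofReal_abs]
  refine Tpsi_le_of_forall (g := fun _ => S) hx hfS fun t ht => ?_
  rw [← lintegral_rpow_mul_exp_neg hc hε ht, ← lintegral_const_mul' _ _ ENNReal.ofReal_ne_top,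
    mul_comm _ S, ← lintegral_const_mul _ (by fun_prop)]
  refine le_trans (setLIntegral_mono' measurableSet_Ioi fun y hy => ?_)
    (lintegral_mono_set (Ioi_subset_Ioi hx.le))
  have hy : x < y := hy
  have hy0 : 0 < y := hx.trans hy
  rw [mul_assoc, mul_left_comm, ← ENNReal.ofReal_mul (by positivity),
    ← ENNReal.ofReal_mul (by positivity), mul_left_comm]
  gcongr
  rw [Real.rpow_sub_one hy0.ne', Real.rpow_neg hy0.le, ← mul_div_assoc, ← div_eq_mul_inv,
    inv_eq_one_div]
  gcongr
  rw [div_le_one (by positivity)]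
  exact Real.rpow_le_rpow hx.le hy.le hξ

lemma Tpsi_rpow_le {c ε ξ p x : ℝ} (hc : 0 < c) (hε : 0 < ε) (hp : 1 ≤ p) {f : ℝ → ℝ}
    {g : ℝ → ℝ≥0∞} (hg : Measurable g)
    (hfg : ∀ᵐ y ∂volume.restrict (Ioi (0:ℝ)), ENNReal.ofReal |f y| ≤ g y) (hx : 0 < x) :
    Tpsi c ε ξ f x ^ p ≤ ENNReal.ofReal (x ^ (ξ * p)) *
      (ENNReal.ofReal ((c ^ (-ε) * (1 / 2) * Real.Gamma ε) ^ (p - 1) * (ε / c) ^ ε) *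
        ∫⁻ y, g y ^ p ∂powMeasure (-ξ * p - 1)) := by
  have hp0 : 0 < p := by linarith
  have hΓ := Real.Gamma_pos_of_pos hε
  rw [← ENNReal.le_rpow_inv_iff hp0]
  refine Tpsi_le_of_forall hx hfg fun t ht => ?_
  rw [ENNReal.le_rpow_inv_iff hp0, ENNReal.mul_rpow_of_nonneg _ _ hp0.le,
    ENNReal.ofReal_rpow_of_pos (by positivity), ← Real.rpow_mul hx.le]
  gcongr
  have e1 : ∫⁻ y in Ioi x, g y *
      ENNReal.ofReal ((y ^ 2 / t) ^ ε * Real.exp (-(c * y ^ 2) / t)) *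
      ENNReal.ofReal (y ^ (-ξ - 1)) = ∫⁻ y in Ioi x, (g y * ENNReal.ofReal (y ^ (-ξ))) *
        ENNReal.ofReal ((y ^ 2 / t) ^ ε * Real.exp (-(c * y ^ 2) / t) * y⁻¹) := by
    refine setLIntegral_congr_fun measurableSet_Ioi fun y hy => ?_
    have hy : 0 < y := hx.trans hy
    rw [mul_assoc, mul_assoc, ← ENNReal.ofReal_mul (by positivity),
      ← ENNReal.ofReal_mul (by positivity), Real.rpow_sub_one hy.ne']
    congr 2
    ring
  rw [e1]
  refine (lintegral_mul_rpow_le (by fun_prop) (by fun_prop) hp).trans ?_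
  rw [ENNReal.ofReal_mul (by positivity), mul_assoc,
    ← ENNReal.ofReal_rpow_of_nonneg (by positivity) (by linarith)]
  have hp1 : 0 ≤ p - 1 := by linarith
  gcongr ?_ ^ (p - 1) * ?_
  · rw [← lintegral_rpow_mul_exp_neg hc hε ht]
    exact lintegral_mono_set (Ioi_subset_Ioi hx.le)
  · rw [lintegral_powMeasure, ← lintegral_const_mul' _ _ ENNReal.ofReal_ne_top]
    refine le_trans (setLIntegral_mono' measurableSet_Ioi fun y hy => ?_)
      (lintegral_mono_set (Ioi_subset_Ioi hx.le))
    have hy : 0 < y := hx.trans hy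
    rw [ENNReal.mul_rpow_of_nonneg _ _ hp0.le, ENNReal.ofReal_rpow_of_pos (by positivity),
      ← Real.rpow_mul hy.le, mul_assoc, ← ENNReal.ofReal_mul (by positivity),
      mul_comm (g y ^ p), ← mul_assoc (ENNReal.ofReal ((ε / c) ^ ε)),
      ← ENNReal.ofReal_mul (by positivity)]
    refine mul_le_mul_left (ENNReal.ofReal_le_ofReal ?_) _
    rw [Real.rpow_sub_one hy.ne', mul_left_comm, ← div_eq_mul_inv]
    refine mul_le_mul_of_nonneg_right ?_ (by positivity)
    exact rpow_mul_exp_neg_le hc hε ht y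

lemma ae_powMeasure_pos (δ : ℝ) : ∀ᵐ x ∂powMeasure δ, 0 < x :=
  (powMeasure_absolutelyContinuous δ).ae_le (ae_restrict_mem measurableSet_Ioi)

lemma powMeasure_le_setLIntegral {δ : ℝ} {S U : Set ℝ} (hU : MeasurableSet U)
    (hSU : ∀ x ∈ S, 0 < x → x ∈ U) :
    powMeasure δ S ≤ ∫⁻ x in U, ENNReal.ofReal (x ^ δ) := by
  calc powMeasure δ S ≤ powMeasure δ U := measure_mono_ae ((ae_powMeasure_pos δ).mono fun x hx hxS => hSU x hxS hx)
    _ ≤ _ := by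
      rw [powMeasure, withDensity_apply _ hU, Measure.restrict_restrict hU]
      exact lintegral_mono_set inter_subset_left

lemma powMeasure_setOf_lt_rpow_le {s r : ℝ} (hs : s ≠ 0) (hr : 0 < r) :
    powMeasure (-s - 1) {x | r < x ^ s} ≤ ENNReal.ofReal (r⁻¹ / |s|) := by
  obtain ⟨a, ha, rfl⟩ : ∃ a : ℝ, 0 < a ∧ a ^ s = r :=
    ⟨r ^ s⁻¹, by positivity, Real.rpow_inv_rpow hr.le hs⟩
  rcases hs.lt_or_gt with hs | hs
  · refine (powMeasure_le_setLIntegral (measurableSet_Ioo (a := 0) (b := a))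
      fun x hx hx0 => ⟨hx0, ?_⟩).trans (le_of_eq ?_)
    · exact (Real.rpow_lt_rpow_iff_of_neg ha hx0 hs).1 hx
    · rw [setLIntegral_Ioo_rpow ha (by linarith), sub_add_cancel, abs_of_neg hs,
        Real.rpow_neg ha.le]
  · refine (powMeasure_le_setLIntegral (measurableSet_Ioi (a := a))
      fun x hx hx0 => ?_).trans (le_of_eq ?_)
    · exact (Real.rpow_lt_rpow_iff ha.le hx0.le hs).1 hx
    · rw [setLIntegral_Ioi_rpow ha (by linarith), sub_add_cancel, abs_of_pos hs, neg_neg,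
        Real.rpow_neg ha.le]

lemma MemLpPow.exists_measurable {f : ℝ → ℝ} {p δ : ℝ} (hf : MemLpPow f p δ) :
    ∃ g : ℝ → ℝ≥0∞, Measurable g ∧
      (∀ᵐ y ∂volume.restrict (Ioi (0:ℝ)), ENNReal.ofReal |f y| ≤ g y) ∧
      ∫⁻ x, g x ^ p ∂powMeasure δ = ∫⁻ x, ENNReal.ofReal |f x| ^ p ∂powMeasure δ := by
  have hm : AEMeasurable (fun x => ENNReal.ofReal |f x|) (powMeasure δ) := by
    have := hf.1
    fun_prop
  exact ⟨hm.mk _, hm.measurable_mk,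
    (absolutelyContinuous_powMeasure δ).ae_le (hm.ae_eq_mk.mono fun _ h => h.le),
    lintegral_congr_ae (hm.ae_eq_mk.mono fun _ h => congrArg (· ^ p) h.symm)⟩

lemma exists_hardyDual_majorant {c ε ξ δ p : ℝ} (hc : 0 < c) (hε : 0 < ε) (hp : 1 ≤ p)
    (hδ : -ξ * p - 1 < δ) :
    ∃ C : ℝ≥0, ∀ f : ℝ → ℝ, MemLpPow f p δ → ∃ F : ℝ → ℝ≥0∞, Measurable F ∧
      (∀ᵐ x ∂powMeasure δ, Tpsi c ε ξ f x ≤ F x) ∧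
      ∫⁻ x, F x ^ p ∂powMeasure δ ≤ C * ∫⁻ x, ENNReal.ofReal |f x| ^ p ∂powMeasure δ := by
  have hp0 : 0 < p := by linarith
  obtain ⟨C, hC⟩ := lintegral_hardyDual_rpow_le (ξ := ξ) hp hδ
  refine ⟨Real.toNNReal (((ε / c) ^ ε) ^ p) * C, fun f hf => ?_⟩
  obtain ⟨g, hg, hfg, hgp⟩ := hf.exists_measurable
  refine ⟨fun x => ENNReal.ofReal ((ε / c) ^ ε) * hardyDual ξ g x,
    (measurable_hardyDual ξ g).const_mul _,
    (ae_powMeasure_pos δ).mono fun x hx => Tpsi_le_hardyDual hc hε hfg hx, ?_⟩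
  simp only [ENNReal.mul_rpow_of_nonneg _ _ hp0.le]
  rw [lintegral_const_mul _ ((measurable_hardyDual ξ g).pow_const p),
    ENNReal.ofReal_rpow_of_pos (by positivity), ENNReal.coe_mul, mul_assoc, ← hgp]
  exact mul_le_mul_right (hC g hg) _

lemma Tpsi_weak_type_endpoint {c ε ξ p : ℝ} (hc : 0 < c) (hε : 0 < ε) (hp : 1 ≤ p) (hξ : ξ ≠ 0) :
    ∃ C : ℝ≥0, ∀ f : ℝ → ℝ, MemLpPow f p (-ξ * p - 1) → ∀ l : ℝ, 0 < l →
      ENNReal.ofReal (l ^ p) *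
          powMeasure (-ξ * p - 1) {x | ENNReal.ofReal l < Tpsi c ε ξ f x} ≤
        C * ∫⁻ x, ENNReal.ofReal |f x| ^ p ∂powMeasure (-ξ * p - 1) := by
  have hp0 : 0 < p := by linarith
  have hs : ξ * p ≠ 0 := by positivity
  set K := (c ^ (-ε) * (1 / 2) * Real.Gamma ε) ^ (p - 1) * (ε / c) ^ ε with hK
  have hK0 : 0 ≤ K := by
    have := Real.Gamma_pos_of_pos hε
    positivity
  refine ⟨Real.toNNReal (K / |ξ * p|), fun f hf l hl => ?_⟩
  obtain ⟨g, hg, hfg, hgp⟩ := hf.exists_measurable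
  obtain ⟨N, hN0, hN⟩ : ∃ N : ℝ, 0 ≤ N ∧
      ∫⁻ x, ENNReal.ofReal |f x| ^ p ∂powMeasure (-ξ * p - 1) = ENNReal.ofReal N :=
    ⟨_, ENNReal.toReal_nonneg, (ENNReal.ofReal_toReal hf.2.ne).symm⟩
  have hsub : ∀ x, 0 < x → ENNReal.ofReal l < Tpsi c ε ξ f x → l ^ p < x ^ (ξ * p) * (K * N) := by
    intro x hx hlx
    have h1 := (ENNReal.rpow_lt_rpow hlx hp0).trans_le (Tpsi_rpow_le hc hε hp hg hfg hx)
    rw [hgp, hN, ← ENNReal.ofReal_mul hK0, ← ENNReal.ofReal_mul (by positivity),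
      ENNReal.ofReal_rpow_of_pos hl] at h1
    exact (ENNReal.ofReal_lt_ofReal_iff_of_nonneg (by positivity)).1 h1
  rw [hN]
  change _ ≤ ENNReal.ofReal _ * _
  rw [← ENNReal.ofReal_mul (by positivity)]
  have hlp : 0 < l ^ p := by positivity
  rcases (mul_nonneg hK0 hN0).eq_or_lt with h0 | h0
  · have : powMeasure (-ξ * p - 1) {x | ENNReal.ofReal l < Tpsi c ε ξ f x} = 0 := by
      rw [measure_eq_zero_iff_ae_notMem]
      filter_upwards [ae_powMeasure_pos (-ξ * p - 1)] with x hx hlx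
      have := hsub x hx hlx
      rw [← h0] at this
      linarith
    rw [this, mul_zero]
    exact zero_le
  · have h1 : powMeasure (-ξ * p - 1) {x | ENNReal.ofReal l < Tpsi c ε ξ f x} ≤
        ENNReal.ofReal ((l ^ p / (K * N))⁻¹ / |ξ * p|) := by
      refine le_trans (measure_mono_ae ?_)
        (neg_mul ξ p ▸ powMeasure_setOf_lt_rpow_le hs (div_pos hlp h0))
      filter_upwards [ae_powMeasure_pos (-ξ * p - 1)] with x hx hlx
      exact (div_lt_iff₀ h0).2 (hsub x hx hlx)
    refine (mul_le_mul_right h1 _).trans (le_of_eq ?_)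
    rw [← ENNReal.ofReal_mul hlp.le]
    congr 1
    field_simp

theorem stmt9 (c ε ξ δ : ℝ) (hc : 0 < c) (hε : 0 < ε) :
    -- (a) strong type (p,p) for 1 < p < ∞, -ξp - 1 < δ
    (∀ p : ℝ, 1 < p → -ξ * p - 1 < δ →
      ∃ C : ℝ≥0, ∀ f : ℝ → ℝ, MemLpPow f p δ →
        ∫⁻ x, Tpsi c ε ξ f x ^ p ∂(powMeasure δ) ≤
          C * ∫⁻ x, ENNReal.ofReal |f x| ^ p ∂(powMeasure δ)) ∧
    -- (b) strong type (∞,∞) if ξ ≥ 0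
    (0 ≤ ξ →
      ∃ C : ℝ≥0, ∀ f : ℝ → ℝ,
        essSup (Tpsi c ε ξ f) (volume.restrict (Ioi (0:ℝ))) ≤
          C * eLpNorm f ⊤ (volume.restrict (Ioi (0:ℝ)))) ∧
    -- (c) weak type (p,p) for 1 ≤ p < ∞, -ξp - 1 ≤ δ (strict if ξ = 0)
    (∀ p : ℝ, 1 ≤ p → -ξ * p - 1 ≤ δ → (ξ = 0 → -ξ * p - 1 < δ) →
      ∃ C : ℝ≥0, ∀ f : ℝ → ℝ, MemLpPow f p δ → ∀ l : ℝ, 0 < l →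
        ENNReal.ofReal (l ^ p) * powMeasure δ {x | ENNReal.ofReal l < Tpsi c ε ξ f x} ≤
          C * ∫⁻ x, ENNReal.ofReal |f x| ^ p ∂(powMeasure δ)) := by
  refine ⟨fun p hp hδ => ?_, fun hξ => ?_, fun p hp hδ hξδ => ?_⟩
  · obtain ⟨C, hC⟩ := exists_hardyDual_majorant hc hε hp.le hδ
    refine ⟨C, fun f hf => ?_⟩
    obtain ⟨F, -, hTF, hF⟩ := hC f hf
    exact (lintegral_mono_ae (hTF.mono fun x hx =>
      ENNReal.rpow_le_rpow hx (by linarith))).trans hF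
  · refine ⟨Real.toNNReal (c ^ (-ε) * (1 / 2) * Real.Gamma ε), fun f => essSup_le_of_ae_le _ ?_⟩
    filter_upwards [ae_restrict_mem measurableSet_Ioi] with x hx
    exact Tpsi_le_eLpNorm_top hc hε hξ f hx
  · rcases hδ.eq_or_lt with rfl | hδ
    · exact Tpsi_weak_type_endpoint hc hε hp fun h => lt_irrefl _ (hξδ h)
    · have hp0 : 0 < p := by linarith
      obtain ⟨C, hC⟩ := exists_hardyDual_majorant hc hε hp hδ
      refine ⟨C, fun f hf l hl => ?_⟩
      obtain ⟨F, hFm, hTF, hF⟩ := hC f hf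
      refine le_trans ?_ ((mul_meas_ge_le_lintegral (hFm.pow_const p)
        (ENNReal.ofReal (l ^ p))).trans hF)
      refine mul_le_mul_right (measure_mono_ae (hTF.mono fun x hx hlx => ?_)) _
      change ENNReal.ofReal (l ^ p) ≤ F x ^ p
      rw [← ENNReal.ofReal_rpow_of_pos hl]
      exact ENNReal.rpow_le_rpow ((le_of_lt hlx).trans hx) hp0.le

end
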